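/- Let λ = (λ_1,…,λ_n) ∈ Γ₂ with λ_1 ≥ λ_2 ≥ ⋯ ≥ λ_n, let f(λ) = σ₂(λ)/σ₁(λ) and f_i = σ_{1;i}(λ)/σ₁(λ) − σ₂(λ)/σ₁(λ)². Then for every i ≥ 2, f_i ≥ (1 − 1/√2) − f(λ)/σ₁(λ). -/

import Mathlib

/-- The `k`-th elementary symmetric function of `l : Fin n → ℝ`. -/
noncomputable def esymm (n k : ℕ) (l : Fin n → ℝ) : ℝ :=
  ∑ s ∈ Finset.univ.powersetCard k, ∏ i ∈ s, l i

theorem esymm_one (n : ℕ) (l : Fin n → ℝ) : esymm n 1 l = ∑ j, l j := by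
  simp [esymm, Finset.powersetCard_one]

theorem Finset.two_mul_sum_powersetCard_two_prod {ι R : Type*} [CommRing R]
    (s : Finset ι) (f : ι → R) :
    2 * ∑ t ∈ s.powersetCard 2, ∏ j ∈ t, f j = (∑ j ∈ s, f j) ^ 2 - ∑ j ∈ s, f j ^ 2 := by
  classical
  induction s using Finset.induction_on with
  | empty => simp [Finset.powersetCard_eq_empty (s := (∅ : Finset ι)).2 (by simp : _ < 2)]
  | insert a s ha ih =>
    have hnot : ∀ t ∈ s.powersetCard 1, a ∉ t := fun t ht hat =>
      ha ((Finset.mem_powersetCard.1 ht).1 hat)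
    have hdisj : Disjoint (s.powersetCard 2) ((s.powersetCard 1).image (insert a)) := by
      refine Finset.disjoint_left.2 fun t ht ht' => ?_
      obtain ⟨u, -, rfl⟩ := Finset.mem_image.1 ht'
      exact ha ((Finset.mem_powersetCard.1 ht).1 (Finset.mem_insert_self a u))
    have hinj : Set.InjOn (insert a) (s.powersetCard 1 : Set (Finset ι)) := by
      intro t ht u hu h
      rw [← Finset.erase_insert (hnot t ht), h, Finset.erase_insert (hnot u hu)]
    have himage : ∑ t ∈ (s.powersetCard 1).image (insert a), ∏ j ∈ t, f j
        = f a * ∑ j ∈ s, f j := by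
      rw [Finset.sum_image hinj,
        Finset.sum_congr rfl fun t ht => Finset.prod_insert (hnot t ht), ← Finset.mul_sum]
      simp [Finset.powersetCard_one]
    rw [Finset.powersetCard_succ_insert ha, Finset.sum_union hdisj, himage, mul_add, ih,
      Finset.sum_insert ha, Finset.sum_insert ha]
    ring

theorem sqrt_two_mul_le_esymm_one {n : ℕ} {l : Fin n → ℝ} (h1 : 0 ≤ esymm n 1 l)
    (h2 : 0 ≤ esymm n 2 l) {i j : Fin n} (hij : i ≠ j) (hle : l i ≤ l j) :
    √2 * l i ≤ esymm n 1 l := by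
  rcases le_total (l i) 0 with hi | hi
  · exact (mul_nonpos_of_nonneg_of_nonpos (Real.sqrt_nonneg 2) hi).trans h1
  have hpair : l i ^ 2 + l j ^ 2 ≤ ∑ k, l k ^ 2 := by
    rw [← Finset.sum_pair (f := fun k => l k ^ 2) hij]
    exact Finset.sum_le_sum_of_subset_of_nonneg (Finset.subset_univ _) fun k _ _ => sq_nonneg _
  have hsq : 2 * esymm n 2 l = esymm n 1 l ^ 2 - ∑ k, l k ^ 2 := by
    rw [esymm_one]
    exact Finset.two_mul_sum_powersetCard_two_prod _ _
  have hlesq : l i ^ 2 ≤ l j ^ 2 := pow_le_pow_left₀ hi hle 2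
  refine (pow_le_pow_iff_left₀ (by positivity) h1 two_ne_zero).1 ?_
  rw [mul_pow, Real.sq_sqrt zero_le_two]
  linarith

/-- for `λ ∈ Γ₂` ordered decreasingly, with `f = σ₂/σ₁` and
`f_i = σ_{1;i}/σ₁ − σ₂/σ₁²`, for every `i ≥ 2` (i.e. every index other than the first)
one has `f_i ≥ (1 − 1/√2) − f(λ)/σ₁(λ)`. -/
theorem stmt7 (n : ℕ) (l : Fin n → ℝ)
    (hΓ1 : 0 < esymm n 1 l) (hΓ2 : 0 < esymm n 2 l)
    (hord : ∀ i j : Fin n, i ≤ j → l j ≤ l i)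
    (i : Fin n) (hi : 1 ≤ (i : ℕ)) :
    (1 - 1 / Real.sqrt 2) - (esymm n 2 l / esymm n 1 l) / esymm n 1 l
      ≤ esymm n 1 (Function.update l i 0) / esymm n 1 l
          - esymm n 2 l / (esymm n 1 l) ^ 2 := by
  have hn : 0 < n := i.pos
  have hle : √2 * l i ≤ esymm n 1 l :=
    sqrt_two_mul_le_esymm_one hΓ1.le hΓ2.le (j := ⟨0, hn⟩)
      (fun h => by simp [h] at hi) (hord _ _ (Fin.mk_le_of_le_val (Nat.zero_le _)))
  have hupdate : esymm n 1 (Function.update l i 0) = esymm n 1 l - l i := by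
    rw [esymm_one, esymm_one, Finset.sum_update_of_mem (Finset.mem_univ i), zero_add,
      ← Finset.sum_sdiff (Finset.subset_univ {i}), Finset.sum_singleton, add_sub_cancel_right]
  have hdiv : l i / esymm n 1 l ≤ 1 / √2 := by
    rw [div_le_div_iff₀ hΓ1 (by positivity)]
    linarith
  rw [hupdate, sub_div, div_self hΓ1.ne', div_div, ← sq]
  linarith
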